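/- Let l > 0 be a real number and n ≥ 3 a natural number. Set A = (0,0), B = (l,l), D = ((3−n)l, (1−n)l) and T = (0, 2l). Let P be a point on the line y = −x that is collinear with D and B, and let C be a point on the line y = x that is collinear with P and T. Then the taxicab distance from A to C equals 2l/n; that is, since the taxicab distance from A to B is 2l, the point C divides the segment AB so that d_t(A,C) = d_t(A,B)/n. -/

import Mathlib

/-- The taxicab (L¹) distance between two points of ℝ². -/
def taxicabDist (p q : ℝ × ℝ) : ℝ := |q.1 - p.1| + |q.2 - p.2|

/-- Three collinear points of `K²` span a parallelogram of zero signed area. -/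
theorem Collinear.cross_eq_zero {K : Type*} [Field K] {p q r : K × K}
    (h : Collinear K ({p, q, r} : Set (K × K))) :
    (q.1 - p.1) * (r.2 - p.2) = (q.2 - p.2) * (r.1 - p.1) := by
  obtain ⟨v, hv⟩ := (collinear_iff_of_mem (p₀ := p) (by simp)).1 h
  obtain ⟨s, rfl⟩ := hv q (by simp)
  obtain ⟨t, rfl⟩ := hv r (by simp)
  simp only [vadd_eq_add, Prod.fst_add, Prod.snd_add, Prod.smul_fst, Prod.smul_snd, smul_eq_mul]
  ring

/-- Sectioning construction: with `A = (0,0)`, `B = (l,l)`, `D = ((3-n)l, (1-n)l)`,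
`T = (0, 2l)`, any point `P` on the line `y = -x` collinear with `D` and `B`, and any
point `C` on the line `y = x` collinear with `P` and `T`, satisfy
`d_t(A, C) = 2l/n = d_t(A, B)/n`. -/
theorem taxicab_angle_section (l : ℝ) (hl : 0 < l) (n : ℕ) (hn : 3 ≤ n)
    (A B D T P C : ℝ × ℝ)
    (hA : A = (0, 0)) (hB : B = (l, l))
    (hD : D = ((3 - (n : ℝ)) * l, (1 - (n : ℝ)) * l)) (hT : T = (0, 2 * l))
    (hP : P.2 = -P.1) (hDBP : Collinear ℝ ({D, B, P} : Set (ℝ × ℝ)))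
    (hC : C.2 = C.1) (hPTC : Collinear ℝ ({P, T, C} : Set (ℝ × ℝ))) :
    taxicabDist A C = 2 * l / n ∧ taxicabDist A B = 2 * l := by
  have hn' : (3 : ℝ) ≤ n := by exact_mod_cast hn
  obtain ⟨x, y⟩ := P
  obtain ⟨c, d⟩ := C
  subst hA hB hD hT
  simp only at hP hC
  subst hP hC
  have hDB := hDBP.cross_eq_zero
  have hPT := hPTC.cross_eq_zero
  simp only at hDB hPT
  have hx : x * (n - 1) = l := by
    refine mul_left_cancel₀ (mul_ne_zero two_ne_zero hl.ne') ?_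
    linear_combination -hDB
  have hx0 : 0 < x := by
    by_contra hneg
    nlinarith
  have hc : d = l / n := by
    rw [eq_div_iff (by positivity)]
    refine mul_left_cancel₀ (mul_ne_zero two_ne_zero hx0.ne') ?_
    linear_combination -hPT + 2 * d * hx
  have hd : 0 < d := hc ▸ by positivity
  simp only [taxicabDist, sub_zero, abs_of_pos hd, abs_of_pos hl]
  exact ⟨by rw [hc]; ring, by ring⟩
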